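/- Let (Ω, ℱ, P) be a probability space, 𝒢 ⊆ ℱ a sub-σ-algebra, a a nonnegative integrable 𝒢-measurable random variable, and U a random variable uniformly distributed on [0,1] whose σ-algebra is independent of 𝒢. Define the offspring number o := ⌊a⌋ + 1_{U < a − ⌊a⌋}. Then o is integrable and E[o | 𝒢] = a almost surely. -/

import Mathlib

open MeasureTheory ProbabilityTheory

lemma offspring_aux {Ω : Type*} {𝒢 : MeasurableSpace Ω} {mΩ : MeasurableSpace Ω} (P : Measure Ω)
    [IsProbabilityMeasure P] (h𝒢 : 𝒢 ≤ mΩ) (U Z : Ω → ℝ) (hU : Measurable U)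
    (hZ : Measurable[𝒢] Z) (h0 : ∀ ω, 0 ≤ Z ω) (h1 : ∀ ω, Z ω ≤ 1)
    (hunif : P.map U = (volume : Measure ℝ).restrict (Set.Icc 0 1))
    (hind : Indep (MeasurableSpace.comap U Real.measurableSpace) 𝒢 P) :
    P {ω | U ω < Z ω} = ∫⁻ ω, ENNReal.ofReal (Z ω) ∂P := by
  have hZ' : Measurable Z := hZ.mono h𝒢 le_rfl
  have hi : IndepFun Z U P := by
    rw [IndepFun_iff_Indep]
    exact (indep_of_indep_of_le_right hind hZ.comap_le).symm
  have hmap := (indepFun_iff_map_prod_eq_prod_map_map hZ'.aemeasurable hU.aemeasurable).1 hi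
  have hS : MeasurableSet {p : ℝ × ℝ | p.2 < p.1} := measurableSet_lt measurable_snd measurable_fst
  have e : P {ω | U ω < Z ω} = (P.map (fun ω => (Z ω, U ω))) {p : ℝ × ℝ | p.2 < p.1} := by
    rw [Measure.map_apply (hZ'.prodMk hU) hS]; rfl
  have hsf : SFinite (P.map U) := by infer_instance
  have hm : Measurable fun z => (P.map U) (Prod.mk z ⁻¹' {p : ℝ × ℝ | p.2 < p.1}) :=
    measurable_measure_prodMk_left hS
  rw [e, hmap, Measure.prod_apply hS, lintegral_map hm hZ']
  refine lintegral_congr fun ω => ?_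
  have e2 : Prod.mk (Z ω) ⁻¹' {p : ℝ × ℝ | p.2 < p.1} = Set.Iio (Z ω) := by ext; simp
  rw [e2, hunif, Measure.restrict_apply measurableSet_Iio]
  have e3 : Set.Iio (Z ω) ∩ Set.Icc 0 1 = Set.Ico 0 (Z ω) := by
    ext x
    have := h1 ω
    simp only [Set.mem_inter_iff, Set.mem_Iio, Set.mem_Icc, Set.mem_Ico]
    constructor
    · rintro ⟨a, b, c⟩; exact ⟨b, a⟩
    · rintro ⟨a, b⟩; exact ⟨b, a, by linarith⟩
  rw [e3, Real.volume_Ico, sub_zero]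

lemma offspring_aux2 {Ω : Type*} {𝒢 : MeasurableSpace Ω} {mΩ : MeasurableSpace Ω} (P : Measure Ω)
    [IsProbabilityMeasure P] (h𝒢 : 𝒢 ≤ mΩ) (a : Ω → ℝ) (ha : Measurable[𝒢] a)
    (hai : Integrable a P) (U : Ω → ℝ) (hU : Measurable U)
    (hunif : P.map U = (volume : Measure ℝ).restrict (Set.Icc 0 1))
    (hind : Indep (MeasurableSpace.comap U Real.measurableSpace) 𝒢 P) :
    Integrable (fun ω => (⌊a ω⌋ : ℝ) + (if U ω < a ω - ⌊a ω⌋ then (1 : ℝ) else 0)) P ∧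
    P[fun ω => (⌊a ω⌋ : ℝ) + (if U ω < a ω - ⌊a ω⌋ then (1 : ℝ) else 0)|𝒢] =ᵐ[P] a := by
  have ha' : Measurable a := ha.mono h𝒢 le_rfl
  have hflm : Measurable[𝒢] (fun ω => (⌊a ω⌋ : ℝ)) :=
    (measurable_from_top (f := fun n : ℤ => (n : ℝ))).comp (Int.measurable_floor.comp ha)
  have hfrm : Measurable[𝒢] (fun ω => a ω - ⌊a ω⌋) := ha.sub hflm
  have hfrm' : Measurable (fun ω => a ω - ⌊a ω⌋) := hfrm.mono h𝒢 le_rfl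
  have h0 : ∀ ω, 0 ≤ a ω - ⌊a ω⌋ := fun ω => sub_nonneg.2 (Int.floor_le _)
  have h1 : ∀ ω, a ω - ⌊a ω⌋ ≤ 1 := fun ω => by linarith [Int.lt_floor_add_one (a ω)]
  have hfri : Integrable (fun ω => a ω - ⌊a ω⌋) P :=
    Integrable.of_bound hfrm'.aestronglyMeasurable 1
      (Filter.Eventually.of_forall fun ω => by rw [Real.norm_eq_abs, abs_of_nonneg (h0 ω)]; exact h1 ω)
  have hfli : Integrable (fun ω => (⌊a ω⌋ : ℝ)) P := by
    have := hai.sub hfri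
    refine this.congr (Filter.Eventually.of_forall fun ω => ?_)
    simp
  have hA : MeasurableSet {ω | U ω < a ω - ⌊a ω⌋} := measurableSet_lt hU hfrm'
  have hind_meas : Measurable (fun ω => if U ω < a ω - ⌊a ω⌋ then (1 : ℝ) else 0) :=
    Measurable.ite hA measurable_const measurable_const
  have hii : Integrable (fun ω => if U ω < a ω - ⌊a ω⌋ then (1 : ℝ) else 0) P :=
    Integrable.of_bound hind_meas.aestronglyMeasurable 1
      (Filter.Eventually.of_forall fun ω => by split_ifs <;> simp)
  have hoi := hfli.add hii
  refine ⟨hoi, ?_⟩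
  refine (ae_eq_condExp_of_forall_setIntegral_eq h𝒢 hoi (fun s _ _ => hai.integrableOn) ?_
    ha.stronglyMeasurable.aestronglyMeasurable).symm
  intro s hs _
  have hs' : MeasurableSet s := h𝒢 s hs
  have hU0 : ∀ᵐ ω ∂P, 0 ≤ U ω := by
    have : ∀ᵐ u ∂(P.map U), 0 ≤ u := by
      rw [hunif]
      filter_upwards [ae_restrict_mem measurableSet_Icc] with u hu using hu.1
    exact ae_of_ae_map hU.aemeasurable this
  have key : ∫ ω in s, (if U ω < a ω - ⌊a ω⌋ then (1 : ℝ) else 0) ∂P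
      = ∫ ω in s, (a ω - ⌊a ω⌋) ∂P := by
    set Z : Ω → ℝ := s.indicator (fun ω => a ω - ⌊a ω⌋) with hZdef
    have hZ : Measurable[𝒢] Z := hfrm.indicator hs
    have hZ' : Measurable Z := hZ.mono h𝒢 le_rfl
    have hZ0 : ∀ ω, 0 ≤ Z ω := fun ω => Set.indicator_nonneg (fun ω _ => h0 ω) ω
    have hZ1 : ∀ ω, Z ω ≤ 1 := fun ω => Set.indicator_le' (fun ω _ => h1 ω) (fun _ _ => zero_le_one) ω
    have hp := offspring_aux P h𝒢 U Z hU hZ hZ0 hZ1 hunif hind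
    have hB : MeasurableSet {ω | U ω < Z ω} := measurableSet_lt hU hZ'
    rw [← integral_indicator hs', ← integral_indicator hs', ← hZdef,
      integral_eq_lintegral_of_nonneg_ae (Filter.Eventually.of_forall hZ0)
        hZ'.aestronglyMeasurable, ← hp]
    have : ∫ ω, ({ω | U ω < Z ω}).indicator (fun _ => (1 : ℝ)) ω ∂P
        = (P {ω | U ω < Z ω}).toReal := by
      rw [integral_indicator hB]; simp [Measure.real]
    rw [← this]
    refine integral_congr_ae ?_
    filter_upwards [hU0] with ω hω
    by_cases h : ω ∈ s
    · simp only [hZdef, Set.indicator, h, if_true, Set.mem_setOf_eq]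
    · simp [hZdef, Set.indicator, h, hω]
  have hadd : ∫ ω in s, ((⌊a ω⌋ : ℝ) + (if U ω < a ω - ⌊a ω⌋ then (1 : ℝ) else 0)) ∂P
      = ∫ ω in s, a ω ∂P := by
    rw [integral_add hfli.integrableOn hii.integrableOn, key,
      ← integral_add hfli.integrableOn hfri.integrableOn]
    simp
  exact hadd.symm


/-- Branching particle filter offspring number: for `𝒢`-measurable `a ≥ 0` integrable
and `U` uniform on `[0,1]` independent of `𝒢`, the offspring number
`o := ⌊a⌋ + 1_{U < a − ⌊a⌋}` is integrable and satisfies `E[o | 𝒢] = a` a.s. -/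
theorem offspring_condexp_eq_target
    {Ω : Type*} {mΩ : MeasurableSpace Ω} (P : Measure Ω) [IsProbabilityMeasure P]
    (𝒢 : MeasurableSpace Ω) (h𝒢 : 𝒢 ≤ mΩ)
    (a : Ω → ℝ) (ha_meas : StronglyMeasurable[𝒢] a) (ha_int : Integrable a P)
    (ha_nonneg : ∀ᵐ ω ∂P, 0 ≤ a ω)
    (U : Ω → ℝ) (hU_meas : @Measurable Ω ℝ mΩ Real.measurableSpace U)
    (hU_unif : @MeasureTheory.Measure.map Ω ℝ mΩ Real.measurableSpace U P =
      (volume : Measure ℝ).restrict (Set.Icc 0 1))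
    (hU_indep : @ProbabilityTheory.Indep Ω
      (MeasurableSpace.comap U Real.measurableSpace) 𝒢 mΩ P)
    (o : Ω → ℝ)
    (ho : o = fun ω => (⌊a ω⌋ : ℝ) + (if U ω < a ω - ⌊a ω⌋ then (1 : ℝ) else 0)) :
    Integrable o P ∧ P[o|𝒢] =ᵐ[P] a := by
  subst ho
  exact offspring_aux2 P h𝒢 a ha_meas.measurable ha_int U hU_meas hU_unif hU_indep
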